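/- Assume c ≥ 2. Then the image in R = 𝕂[T_{ij},S_k]/⟨g_1,…,g_{r−c}⟩ of each of the variables T_{ij} and S_k is a prime element of R, and the images of any two distinct variables are non-associated in R. -/

import Mathlib

open MvPolynomial

noncomputable section

/-- Index type for the variables `T i j` (`Sum.inl ⟨i, j⟩`) and `S k` (`Sum.inr k`). -/
abbrev VarIdx (r m : ℕ) (nn : Fin (r + 1) → ℕ) : Type :=
  (Σ i : Fin (r + 1), Fin (nn i)) ⊕ Fin m

variable (𝕂 : Type) [Field 𝕂]

/-- The monomial `T_i^{l_i} = ∏_j T_{ij}^{l_{ij}}`. -/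
def Tmon (r m : ℕ) (nn : Fin (r + 1) → ℕ)
    (l : ∀ i : Fin (r + 1), Fin (nn i) → ℕ) (i : Fin (r + 1)) :
    MvPolynomial (VarIdx r m nn) 𝕂 :=
  ∏ j : Fin (nn i), (X (Sum.inl ⟨i, j⟩) : MvPolynomial (VarIdx r m nn) 𝕂) ^ l i j

/-- The map sending a column index of the `(c+2)×(c+2)` matrix defining `g_t`
to the corresponding column index of `A`, namely `0, …, c, c + (t+1)`. -/
def colOf (r c : ℕ) (hcr : c ≤ r) (t : Fin (r - c)) (p : Fin (c + 2)) : Fin (r + 1) :=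
  if h : (p : ℕ) ≤ c then ⟨p, by omega⟩
  else ⟨c + 1 + t, by have := t.isLt; omega⟩

/-- The polynomial `g_t`: the determinant of the `(c+2)×(c+2)` matrix whose first
`c+1` rows are formed by the columns `a_0, …, a_c, a_{c+t}` of `A` (as constant
polynomials) and whose last row is `(T_0^{l_0}, …, T_c^{l_c}, T_{c+t}^{l_{c+t}})`. -/
def gPoly (r c m : ℕ) (hcr : c ≤ r) (nn : Fin (r + 1) → ℕ)
    (l : ∀ i : Fin (r + 1), Fin (nn i) → ℕ)
    (A : Matrix (Fin (c + 1)) (Fin (r + 1)) 𝕂) (t : Fin (r - c)) :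
    MvPolynomial (VarIdx r m nn) 𝕂 :=
  Matrix.det (Matrix.of fun q p : Fin (c + 2) =>
    if h : (q : ℕ) < c + 1 then C (A ⟨q, h⟩ (colOf r c hcr t p))
    else Tmon 𝕂 r m nn l (colOf r c hcr t p))

/-- The ring `R = 𝕂[T_{ij}, S_k] / ⟨g_1, …, g_{r-c}⟩`. -/
abbrev RingAP (r c m : ℕ) (hcr : c ≤ r) (nn : Fin (r + 1) → ℕ)
    (l : ∀ i : Fin (r + 1), Fin (nn i) → ℕ)
    (A : Matrix (Fin (c + 1)) (Fin (r + 1)) 𝕂) : Type :=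
  MvPolynomial (VarIdx r m nn) 𝕂 ⧸ Ideal.span (Set.range (gPoly 𝕂 r c m hcr nn l A))

end

theorem PowerSeries.exists_pow_eq_of_isUnit {E : Type*} [Field E] [IsAlgClosed E] [CharZero E]
    {g : PowerSeries E} (hg : IsUnit g) {n : ℕ} (hn : 0 < n) : ∃ ρ : PowerSeries E, ρ ^ n = g := by
  have hg0 : PowerSeries.constantCoeff g ≠ 0 := (PowerSeries.isUnit_iff_constantCoeff.1 hg).ne_zero
  obtain ⟨c, hc⟩ := IsAlgClosed.exists_pow_nat_eq (PowerSeries.constantCoeff g) hn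
  have hc0 : c ≠ 0 := by
    rintro rfl
    rw [zero_pow hn.ne'] at hc
    exact hg0 hc.symm
  obtain ⟨a, ha, -⟩ := HenselianRing.is_henselian
    (I := Ideal.span {(PowerSeries.X : PowerSeries E)})
    (Polynomial.X ^ n - Polynomial.C g) (Polynomial.monic_X_pow_sub_C g hn.ne') (PowerSeries.C c)
    (by
      rw [Ideal.mem_span_singleton, PowerSeries.X_dvd_iff]
      simp [hc])
    (by
      refine IsUnit.map _ (PowerSeries.isUnit_iff_constantCoeff.2 ?_)
      simp [Polynomial.derivative_X_pow, hc0, hn.ne'])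
  refine ⟨a, ?_⟩
  simpa [Polynomial.IsRoot, sub_eq_zero] using ha

theorem MonomialOrder.degree_monomial_sub_C {σ : Type*} (m : MonomialOrder σ) {B : Type*}
    [CommRing B] [Nontrivial B] {d : σ →₀ ℕ} (hd : d ≠ 0) (b : B) :
    m.degree (monomial d 1 - C b) = d := by
  classical
  have h1 : m.degree (monomial d (1 : B)) = d := by simp [m.degree_monomial]
  rw [m.degree_sub_of_lt, h1]
  rw [h1, m.degree_C, map_zero]
  exact m.toSyn_lt_iff_ne_zero.2 ((m.toSyn_eq_zero_iff d).not.2 hd)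

theorem MonomialOrder.monic_monomial_sub_C {σ : Type*} (m : MonomialOrder σ) {B : Type*}
    [CommRing B] [Nontrivial B] {d : σ →₀ ℕ} (hd : d ≠ 0) (b : B) :
    m.Monic (monomial d 1 - C b) := by
  classical
  rw [MonomialOrder.Monic, MonomialOrder.leadingCoeff, m.degree_monomial_sub_C hd]
  simp [coeff_C, hd.symm]

theorem MvPolynomial.prime_monomial_sub_C_X {σ : Type*} (m : MonomialOrder σ) {E : Type*} [Field E]
    {d : σ →₀ ℕ} (hd : d ≠ 0) :
    Prime (monomial d 1 - C PowerSeries.X : MvPolynomial σ (PowerSeries E)) := by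
  classical
  set g : MvPolynomial σ (PowerSeries E) := monomial d 1 - C PowerSeries.X with hg
  have hg0 : constantCoeff g = -PowerSeries.X := by
    simp [hg, constantCoeff_monomial, hd]
  have hXu : ¬ IsUnit (PowerSeries.X : PowerSeries E) := PowerSeries.X_prime.not_isUnit
  have hdeg : m.degree g = d :=
    m.degree_monomial_sub_C hd _
  have hgne : g ≠ 0 := fun h => PowerSeries.X_ne_zero (R := E) (by
    rw [h, map_zero] at hg0
    exact neg_eq_zero.1 hg0.symm)
  have hmap : map PowerSeries.constantCoeff g = monomial d (1 : E) := by
    simp [hg]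
  have key : ∀ u v, u * v = g → IsUnit (constantCoeff u) → IsUnit u := by
    intro u v huv hu
    have hune : u ≠ 0 := by rintro rfl; simp at huv; exact hgne huv.symm
    have hvne : v ≠ 0 := by rintro rfl; simp at huv; exact hgne huv.symm
    have h1 : map PowerSeries.constantCoeff u * map PowerSeries.constantCoeff v
        = monomial d (1 : E) := by rw [← map_mul, huv, hmap]
    obtain ⟨e, b, -, -, he⟩ := (dvd_monomial_iff_exists one_ne_zero).1 (Dvd.intro _ h1)
    have hc : PowerSeries.constantCoeff (constantCoeff u) ≠ 0 :=
      (PowerSeries.isUnit_iff_constantCoeff.1 hu).ne_zero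
    have he0 : e = 0 := by
      by_contra hne
      apply hc
      have := congrArg constantCoeff he
      rwa [constantCoeff_monomial, if_neg hne, constantCoeff_map] at this
    subst he0
    have hvd : coeff d v ≠ 0 := by
      intro h0
      have := congrArg (coeff d) h1
      rw [he, monomial_zero', coeff_C_mul, coeff_map, h0] at this
      simp at this
    have h2 := m.degree_mul hune hvne
    rw [huv, hdeg] at h2
    have h3 : m.toSyn d ≤ m.toSyn (m.degree v) := m.le_degree (mem_support_iff.2 hvd)
    have h4 : m.degree u = 0 := by
      rw [h2, map_add] at h3
      have h5 := add_le_iff_nonpos_left.1 h3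
      exact m.toSyn_eq_zero_iff _ |>.1 (le_antisymm h5 (m.zero_le _))
    have h6 := m.eq_C_of_degree_eq_zero h4
    rw [h6] at hu ⊢
    simp only [constantCoeff_C] at hu
    exact hu.map C
  refine Irreducible.prime ⟨fun hu => hXu ?_, fun u v huv => ?_⟩
  · have := hu.map constantCoeff
    rw [hg0] at this
    exact (IsUnit.neg_iff _).1 this
  · have h0 : constantCoeff u * constantCoeff v = -PowerSeries.X := by rw [← map_mul, ← huv, hg0]
    rcases (PowerSeries.X_prime (R := E)).neg.irreducible.isUnit_or_isUnit h0.symm with h | h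
    · exact Or.inl (key u v huv.symm h)
    · exact Or.inr (key v u (by rw [mul_comm, huv]) h)

theorem MvPolynomial.not_le_of_mem_support_eval₂Hom {σ B O : Type*} [CommRing B] [CommRing O]
    (φ : B →+* O) (s : Set σ) [DecidablePred (· ∈ s)] (ψ : σ → O) {d : σ →₀ ℕ}
    (hd : ∀ w ∉ s, d w = 0) {p : MvPolynomial σ B} (hp : ∀ c ∈ p.support, ¬ d ≤ c) :
    ∀ c ∈ (eval₂Hom ((C : O →+* MvPolynomial σ O).comp φ)
      (fun w => if w ∈ s then X w else C (ψ w)) p).support, ¬ d ≤ c := by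
  classical
  intro c hc hdc
  rw [coe_eval₂Hom, eval₂_eq] at hc
  obtain ⟨e, he, hce⟩ := Finset.mem_biUnion.1 (support_sum hc)
  refine hp e he ?_
  have h1 : ∏ w ∈ e.support, (if w ∈ s then X w else C (ψ w) : MvPolynomial σ O) ^ e w =
      monomial (e.filter (· ∈ s)) (∏ w ∈ e.support with w ∉ s, ψ w ^ e w) := by
    rw [← Finset.prod_filter_mul_prod_filter_not e.support (· ∈ s), monomial_eq, mul_comm]
    congr 1
    · rw [map_prod]
      refine Finset.prod_congr rfl fun w hw => ?_
      rw [if_neg (Finset.mem_filter.1 hw).2, map_pow]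
    · rw [Finsupp.prod, Finsupp.support_filter]
      refine Finset.prod_congr rfl fun w hw => ?_
      rw [if_pos (Finset.mem_filter.1 hw).2,
        Finsupp.filter_apply_pos _ _ (Finset.mem_filter.1 hw).2]
  rw [h1, RingHom.comp_apply, C_mul_monomial] at hce
  have h2 := Finset.mem_singleton.1 (support_monomial_subset hce)
  subst h2
  intro w
  by_cases hw : w ∈ s
  · have := hdc w
    rwa [Finsupp.filter_apply_pos _ _ hw] at this
  · rw [hd w hw]
    exact Nat.zero_le _

theorem MvPolynomial.exists_eq_mul_add_of_dvd_eval₂Hom {σ B O : Type*} [CommRing B] [Nontrivial B]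
    [CommRing O] [IsDomain O] (m : MonomialOrder σ)
    (φ : B →+* O) (s : Set σ) [DecidablePred (· ∈ s)] (ψ : σ → O) {d : σ →₀ ℕ} (hd0 : d ≠ 0)
    (hd : ∀ w ∉ s, d w = 0) (b : B) (t : O) (p : MvPolynomial σ B)
    (hp : monomial d 1 - C t ∣ eval₂Hom ((C : O →+* MvPolynomial σ O).comp φ)
      (fun w => if w ∈ s then X w else C (ψ w)) p)
    (hbt : φ b = t) :
    ∃ q r, p = q * (monomial d 1 - C b) + r ∧ eval₂Hom ((C : O →+* MvPolynomial σ O).comp φ)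
      (fun w => if w ∈ s then X w else C (ψ w)) r = 0 := by
  classical
  set Ψ := eval₂Hom ((C : O →+* MvPolynomial σ O).comp φ)
      (fun w => if w ∈ s then X w else C (ψ w)) with hΨ
  obtain ⟨q, r, hqr, -, hr⟩ := MonomialOrder.div_single (m := m)
    (by rw [(m.monic_monomial_sub_C hd0 b).leadingCoeff_eq_one]; exact isUnit_one) p
  refine ⟨q, r, hqr, ?_⟩
  rw [m.degree_monomial_sub_C hd0] at hr
  have hg : Ψ (monomial d 1 - C b) = monomial d 1 - C t := by
    rw [map_sub]
    congr 1
    · rw [hΨ, coe_eval₂Hom, eval₂_monomial, monomial_eq, map_one, map_one]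
      congr 1
      refine Finsupp.prod_congr fun w hw => ?_
      rw [if_pos]
      by_contra hws
      exact Finsupp.mem_support_iff.1 hw (hd w hws)
    · simp [hΨ, hbt]
  have hdvd : monomial d 1 - C t ∣ Ψ r := by
    rw [hqr, map_add, map_mul, hg] at hp
    exact (dvd_add_right (Dvd.intro_left _ rfl)).1 hp
  obtain ⟨h, hh⟩ := hdvd
  by_contra hne
  have h1 : h ≠ 0 := by rintro rfl; exact hne (by rw [hh, mul_zero])
  have h2 := m.degree_mul (m.monic_monomial_sub_C hd0 t).ne_zero h1
  rw [m.degree_monomial_sub_C hd0, ← hh] at h2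
  exact not_le_of_mem_support_eval₂Hom φ s ψ hd hr _ (m.degree_mem_support hne)
    (h2 ▸ le_self_add)

theorem MvPolynomial.monomial_sum_single {σ R J : Type*} [CommSemiring R] (t : Finset J) (x : J → σ)
    (e : J → ℕ) :
    monomial (∑ j ∈ t, Finsupp.single (x j) (e j)) (1 : R) = ∏ j ∈ t, X (x j) ^ e j := by
  rw [monomial_sum_one]
  exact Finset.prod_congr rfl fun j _ => X_pow_eq_monomial.symm

section RadicalExtension

variable {B : Type*} [CommRing B] {ι : Type*} {κ : ι → Type*} [∀ i, Fintype (κ i)]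

/-- The polynomial `∏_j X_{ij} ^ l_{ij} - f_i` with coefficients in a ring containing `f_i`. -/
noncomputable def radicalPoly (l : ∀ i, κ i → ℕ) (f : ι → B) (i : ι) :
    MvPolynomial (Σ i, κ i) B :=
  ∏ j, X ⟨i, j⟩ ^ l i j - C (f i)

variable (l : ∀ i, κ i → ℕ) (f : ι → B)

theorem eval₂Hom_radicalPoly {O : Type*} [CommRing O] (φ : B →+* O) (ψ : (Σ i, κ i) → O) (i : ι) :
    eval₂Hom φ ψ (radicalPoly l f i) = ∏ j, ψ ⟨i, j⟩ ^ l i j - φ (f i) := by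
  simp [radicalPoly]

theorem mem_span_radicalPoly_of_eval₂Hom_eq_zero [IsDomain B] {O : Type*} [CommRing O] [IsDomain O]
    (hl : ∀ i j, 0 < l i j) {s : Set ι} (hJ : (Ideal.span (radicalPoly l f '' s)).IsPrime)
    (j₁ : ∀ i, κ i) (φ : MvPolynomial (Σ i, κ i) B →+* O) (hφ : Function.Injective φ)
    (ψ : (Σ i, κ i) → O) (hfree : ∀ w : Σ i, κ i, (w.1 ∈ s → w.2 ≠ j₁ w.1) → ψ w = φ (X w))
    (hrel : ∀ i ∈ s, ∏ j, ψ ⟨i, j⟩ ^ l i j = φ (C (f i)))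
    {p : MvPolynomial (Σ i, κ i) B} (hp : eval₂Hom (φ.comp C) ψ p = 0) :
    p ∈ Ideal.span (radicalPoly l f '' s) := by
  classical
  set J := Ideal.span (radicalPoly l f '' s) with hJdef
  set Ψ := eval₂Hom (φ.comp C) ψ with hΨ
  have hJΨ : ∀ a ∈ J, Ψ a = 0 := by
    have : J ≤ RingHom.ker Ψ := by
      rw [hJdef, Ideal.span_le]
      rintro _ ⟨i, hi, rfl⟩
      simp only [SetLike.mem_coe, RingHom.mem_ker]
      rw [hΨ, eval₂Hom_radicalPoly, hrel i hi, RingHom.comp_apply, sub_self]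
    exact fun a ha => this ha
  set S := supported B {w : Σ i, κ i | w.1 ∈ s → w.2 ≠ j₁ w.1} with hS
  have hXS : ∀ w : Σ i, κ i, (w.1 ∈ s → w.2 ≠ j₁ w.1) → X w ∈ S := fun w hw =>
    Algebra.subset_adjoin ⟨w, hw, rfl⟩
  have hSφ : ∀ u ∈ S, Ψ u = φ u := by
    intro u hu
    rw [hS, supported_eq_range_rename] at hu
    obtain ⟨u, rfl⟩ := hu
    change (Ψ.comp (rename _).toRingHom) u = (φ.comp (rename _).toRingHom) u
    congr 1
    refine MvPolynomial.ringHom_ext (fun b => by simp [hΨ]) fun w => ?_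
    simp [hΨ, hfree w.1 w.2]
  have halgX : ∀ w, IsAlgebraic S (Ideal.Quotient.mk J (X w)) := by
    intro w
    by_cases hw : w.1 ∈ s → w.2 ≠ j₁ w.1
    · exact isAlgebraic_algebraMap (⟨X w, hXS w hw⟩ : S)
    · push Not at hw
      obtain ⟨i, j⟩ := w
      obtain ⟨hi, rfl⟩ : i ∈ s ∧ j = j₁ i := hw
      have hM : ∏ j ∈ Finset.univ.erase (j₁ i),
          (X ⟨i, j⟩ : MvPolynomial (Σ i, κ i) B) ^ l i j ∈ S :=
        prod_mem fun j hj => pow_mem (hXS ⟨i, j⟩ fun _ => (Finset.mem_erase.1 hj).1) _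
      have hf : C (f i) ∈ S := S.algebraMap_mem (f i)
      refine ⟨Polynomial.C ⟨_, hM⟩ * Polynomial.X ^ l i (j₁ i) - Polynomial.C ⟨_, hf⟩, ?_, ?_⟩
      · intro h0
        have := congrArg (fun q => (q.coeff (l i (j₁ i)) : MvPolynomial (Σ i, κ i) B)) h0
        simp only [Polynomial.coeff_sub, Polynomial.coeff_C_mul, Polynomial.coeff_X_pow_self,
          mul_one, Polynomial.coeff_C, if_neg (hl i (j₁ i)).ne', sub_zero, Polynomial.coeff_zero,
          ZeroMemClass.coe_zero] at this
        exact Finset.prod_ne_zero_iff.2 (fun j _ => pow_ne_zero _ (X_ne_zero _)) this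
      · have h1 : Ideal.Quotient.mk J (radicalPoly l f i) = 0 :=
          Ideal.Quotient.eq_zero_iff_mem.2 (Ideal.subset_span ⟨i, hi, rfl⟩)
        rw [radicalPoly, ← Finset.prod_erase_mul _ _ (Finset.mem_univ (j₁ i)), map_sub, map_mul,
          map_pow] at h1
        rw [map_sub, map_mul, map_pow, Polynomial.aeval_C, Polynomial.aeval_C, Polynomial.aeval_X]
        exact h1
  have halg : ∀ q, IsAlgebraic S (Ideal.Quotient.mk J q) := by
    intro q
    induction q using MvPolynomial.induction_on with
    | C b => exact isAlgebraic_algebraMap (⟨C b, S.algebraMap_mem b⟩ : S)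
    | add p q hp hq => rw [map_add]; exact hp.add hq
    | mul_X p w hp => rw [map_mul]; exact hp.mul (halgX w)
  by_contra hpJ
  have hne : Ideal.Quotient.mk J p ≠ 0 := fun h => hpJ (Ideal.Quotient.eq_zero_iff_mem.1 h)
  have hker := Ideal.comap_ne_bot_of_algebraic_mem (I := RingHom.ker (Ideal.Quotient.lift J Ψ hJΨ))
    hne (by rw [RingHom.mem_ker, Ideal.Quotient.lift_mk, hp]) (halg p)
  apply hker
  rw [eq_bot_iff]
  intro u hu
  have hu' : Ψ (u : MvPolynomial (Σ i, κ i) B) = 0 := hu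
  rw [hSφ _ u.2, map_eq_zero_iff φ hφ] at hu'
  exact Subtype.ext hu'

theorem isPrime_span_radicalPoly [IsDomain B] [Finite ι] [∀ i, Nonempty (κ i)]
    (hl : ∀ i j, 0 < l i j) (s : Finset ι)
    (H : ∀ i ∈ s, ∃ (E : Type) (_ : Field E) (_ : IsAlgClosed E) (_ : CharZero E)
      (φ : MvPolynomial (Σ i, κ i) B →+* PowerSeries E), Function.Injective φ ∧
        φ (C (f i)) = PowerSeries.X ∧ (∀ j ∈ s, j ≠ i → IsUnit (φ (C (f j)))) ∧
        ∀ w, IsUnit (φ (X w))) :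
    (Ideal.span (radicalPoly l f '' (s : Set ι))).IsPrime := by
  classical
  induction s using Finset.induction_on with
  | empty => simpa using Ideal.isPrime_bot
  | insert i s hi ih =>
    have hJ := ih fun k hk => by
      obtain ⟨E, h1, h2, h3, φ, h4, h5, h6, h7⟩ := H k (Finset.mem_insert_of_mem hk)
      exact ⟨E, h1, h2, h3, φ, h4, h5, fun j hj => h6 j (Finset.mem_insert_of_mem hj), h7⟩
    obtain ⟨E, _, _, _, φ, hφ, hφi, hφj, hφX⟩ := H i (Finset.mem_insert_self i s)
    have j₁ : ∀ i, κ i := fun i => Classical.arbitrary _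
    have hroot : ∀ k, ∃ ρ : PowerSeries E, k ∈ s →
        ρ ^ l k (j₁ k) * ∏ j ∈ Finset.univ.erase (j₁ k), φ (X ⟨k, j⟩) ^ l k j = φ (C (f k)) := by
      intro k
      by_cases hk : k ∈ s
      · have hu : IsUnit (∏ j ∈ Finset.univ.erase (j₁ k), φ (X ⟨k, j⟩) ^ l k j) :=
          (IsUnit.prod_iff).2 fun j _ => (hφX _).pow _
        obtain ⟨v, hv⟩ := hu
        obtain ⟨ρ, hρ⟩ := PowerSeries.exists_pow_eq_of_isUnit
          ((hφj k (Finset.mem_insert_of_mem hk) (by rintro rfl; exact hi hk)).mul (v⁻¹).isUnit)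
          (hl k (j₁ k))
        exact ⟨ρ, fun _ => by rw [hρ, ← hv, mul_assoc, Units.inv_mul, mul_one]⟩
      · exact ⟨0, fun h => absurd h hk⟩
    choose ρ hρ using hroot
    set ψ : (Σ i, κ i) → PowerSeries E := fun w =>
      if w.1 ∈ s ∧ w.2 = j₁ w.1 then ρ w.1 else φ (X w) with hψ
    have hψrel : ∀ k ∈ s, ∏ j, ψ ⟨k, j⟩ ^ l k j = φ (C (f k)) := by
      intro k hk
      rw [← Finset.mul_prod_erase _ _ (Finset.mem_univ (j₁ k)), ← hρ k hk]
      congr 1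
      · simp [hψ, hk]
      · refine Finset.prod_congr rfl fun j hj => ?_
        simp [hψ, (Finset.mem_erase.1 hj).1]
    let m : MonomialOrder (Σ i, κ i) :=
      letI : LinearOrder (Σ i, κ i) := linearOrderOfSTO WellOrderingRel
      MonomialOrder.lex
    set d : (Σ i, κ i) →₀ ℕ := ∑ j, Finsupp.single ⟨i, j⟩ (l i j) with hd
    have hd' : ∀ w ∉ {w : Σ i, κ i | w.1 = i}, d w = 0 := by
      intro w hw
      rw [hd, Finsupp.finsetSum_apply]
      refine Finset.sum_eq_zero fun j _ => Finsupp.single_eq_of_ne ?_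
      rintro rfl
      exact hw rfl
    have hd0 : d ≠ 0 := by
      intro h0
      have := DFunLike.congr_fun h0 ⟨i, j₁ i⟩
      rw [hd, Finsupp.finsetSum_apply, Finsupp.zero_apply, Finset.sum_eq_zero_iff] at this
      have := this (j₁ i) (Finset.mem_univ _)
      rw [Finsupp.single_eq_same] at this
      exact (hl i (j₁ i)).ne' this
    set Ψ := eval₂Hom ((C : PowerSeries E →+* MvPolynomial (Σ i, κ i) (PowerSeries E)).comp
      (φ.comp C)) (fun w => if w ∈ {w : Σ i, κ i | w.1 = i} then X w else C (ψ w)) with hΨ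
    have hprime : (Ideal.span {(monomial d 1 - C PowerSeries.X :
        MvPolynomial (Σ i, κ i) (PowerSeries E))}).IsPrime :=
      (Ideal.span_singleton_prime (prime_monomial_sub_C_X m hd0).ne_zero).2
        (prime_monomial_sub_C_X m hd0)
    have hJi : Ideal.span (radicalPoly l f '' (insert i s : Finset ι)) =
        (Ideal.span {(monomial d 1 - C PowerSeries.X :
          MvPolynomial (Σ i, κ i) (PowerSeries E))}).comap Ψ := by
      apply le_antisymm
      · rw [Ideal.span_le]
        rintro _ ⟨k, hk, rfl⟩
        simp only [SetLike.mem_coe, Ideal.mem_comap]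
        rw [hΨ, eval₂Hom_radicalPoly]
        rcases Finset.mem_insert.1 hk with rfl | hk
        · simp only [Set.mem_ofPred_eq, if_true, RingHom.comp_apply, hφi]
          rw [hd, monomial_sum_single]
          exact Ideal.subset_span rfl
        · have hki : k ≠ i := fun h => hi (h ▸ hk)
          simp only [Set.mem_ofPred_eq, hki, if_false, RingHom.comp_apply]
          rw [← hψrel k hk]
          simp
      · intro p hp
        rw [Ideal.mem_comap, Ideal.mem_span_singleton] at hp
        obtain ⟨q, r, rfl, hr⟩ := exists_eq_mul_add_of_dvd_eval₂Hom m (φ.comp C) _ ψ hd0 hd' (f i)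
          PowerSeries.X p hp hφi
        have hsub : Ideal.span (radicalPoly l f '' (s : Set ι)) ≤
            Ideal.span (radicalPoly l f '' (insert i s : Finset ι)) :=
          Ideal.span_mono (Set.image_mono (by simp))
        refine Ideal.add_mem _ (Ideal.mul_mem_left _ _ ?_) (hsub ?_)
        · rw [hd, monomial_sum_single]
          exact Ideal.subset_span ⟨i, by simp, rfl⟩
        · refine mem_span_radicalPoly_of_eval₂Hom_eq_zero l f hl hJ j₁ φ hφ ψ ?_ hψrel ?_
          · intro w hw
            rw [hψ]
            exact if_neg fun h => hw h.1 h.2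
          · have h0 := congrArg (eval₂Hom (RingHom.id _) ψ) hr
            rw [map_zero, ← RingHom.comp_apply] at h0
            rw [← h0]
            congr 1
            refine MvPolynomial.ringHom_ext (fun b => by simp) fun w => ?_
            by_cases hw : w.1 = i <;> simp [hw]
    rw [hJi]
    exact hprime.comap Ψ

end RadicalExtension

theorem exists_injective_ringHom_isAlgClosed (R : Type) [CommRing R] [IsDomain R] :
    ∃ (E : Type) (_ : Field E) (_ : IsAlgClosed E) (ε : R →+* E), Function.Injective ε :=
  ⟨AlgebraicClosure (FractionRing R), inferInstance, inferInstance,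
    (algebraMap (FractionRing R) (AlgebraicClosure (FractionRing R))).comp
      (algebraMap R (FractionRing R)),
    (algebraMap (FractionRing R) (AlgebraicClosure (FractionRing R))).injective.comp
      (IsFractionRing.injective R (FractionRing R))⟩

section LinearForms

variable {K : Type} [Field K] {α ι : Type} [Fintype α] {κ : ι → Type} [∀ i, Fintype (κ i)]

/-- The linear form with coefficient vector `b`. -/
noncomputable def linForm (b : α → K) : MvPolynomial α K := ∑ a, C (b a) * X a

theorem coeff_single_linForm (b : α → K) (a : α) :
    coeff (Finsupp.single a 1) (linForm b) = b a := by
  classical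
  simp [linForm, coeff_sum, coeff_C_mul, coeff_X, Finsupp.single_left_inj]

theorem linForm_injective : Function.Injective (linForm : (α → K) → MvPolynomial α K) := by
  intro b b' h
  funext a
  rw [← coeff_single_linForm b, h, coeff_single_linForm]

theorem linForm_sub_C_mul (b b' : α → K) (x : K) :
    linForm b - C x * linForm b' = linForm fun a => b a - x * b' a := by
  simp only [linForm, Finset.mul_sum, ← Finset.sum_sub_distrib, map_sub, map_mul]
  exact Finset.sum_congr rfl fun a _ => by ring

theorem eval₂Hom_linForm {R : Type*} [CommRing R] (φ : K →+* R) (z : α → R) (b : α → K) :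
    eval₂Hom φ z (linForm b) = ∑ a, φ (b a) * z a := by
  simp [linForm]

theorem exists_ringHom_polynomial_linForm_eq_X {τ : Type} {b₀ : α → K} {a₀ : α} (ha₀ : b₀ a₀ ≠ 0) :
    ∃ η : MvPolynomial τ (MvPolynomial α K) →+* Polynomial (MvPolynomial τ (MvPolynomial α K)),
      Function.Injective η ∧ η (C (linForm b₀)) = Polynomial.X ∧
      (∀ b, (η (C (linForm b))).coeff 0 = C (linForm fun a => b a - b a₀ * (b₀ a₀)⁻¹ * b₀ a)) ∧
      ∀ w, η (X w) = Polynomial.C (X w) := by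
  classical
  obtain ⟨ηα, hηC, hηα⟩ : ∃ ηα : MvPolynomial α K →+*
      Polynomial (MvPolynomial τ (MvPolynomial α K)),
      (∀ x, ηα (C x) = Polynomial.C (C (C x))) ∧ ∀ a, ηα (X a) = Polynomial.C (C (X a)) +
        if a = a₀ then Polynomial.C (C (C (b₀ a₀)⁻¹)) *
          (Polynomial.X - Polynomial.C (C (linForm b₀))) else 0 :=
    ⟨eval₂Hom (Polynomial.C.comp (C.comp C)) _, fun x => eval₂Hom_C _ _ x,
      fun a => eval₂Hom_X' _ _ a⟩
  obtain ⟨η, hη, hηX⟩ : ∃ η : MvPolynomial τ (MvPolynomial α K) →+*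
      Polynomial (MvPolynomial τ (MvPolynomial α K)),
      (∀ x, η (C x) = ηα x) ∧ ∀ w, η (X w) = Polynomial.C (X w) :=
    ⟨eval₂Hom ηα _, fun x => eval₂Hom_C _ _ x, fun w => eval₂Hom_X' _ _ w⟩
  have hηlin : ∀ b : α → K, η (C (linForm b)) = Polynomial.C (C (linForm b)) +
      Polynomial.C (C (C (b a₀ * (b₀ a₀)⁻¹))) *
        (Polynomial.X - Polynomial.C (C (linForm b₀))) := by
    intro b
    simp only [hη, linForm, map_sum, map_mul, hηC, hηα, mul_add, Finset.sum_add_distrib]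
    simp [mul_assoc]
  refine ⟨η, ?_, ?_, ?_, hηX⟩
  · refine Function.LeftInverse.injective (g := Polynomial.eval (C (linForm b₀))) fun q => ?_
    have : (Polynomial.evalRingHom (C (linForm b₀))).comp η = RingHom.id _ := by
      refine MvPolynomial.ringHom_ext' (MvPolynomial.ringHom_ext (fun x => ?_) fun a => ?_)
        fun w => ?_
      · simp [hη, hηC]
      · by_cases ha : a = a₀ <;> simp [hη, hηα, ha]
      · simp [hηX]
    exact RingHom.congr_fun this q
  · rw [hηlin, mul_inv_cancel₀ ha₀, map_one, map_one, map_one, one_mul]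
    ring
  · intro b
    rw [hηlin, ← linForm_sub_C_mul]
    simp
    ring

theorem exists_powerSeries_embedding [CharZero K] {τ : Type} (β : ι → α → K) (s : Set ι) {i : ι}
    (hβi : β i ≠ 0) (hβ : ∀ j ∈ s, j ≠ i → ∀ x : K, (fun a => β j a - x * β i a) ≠ 0) :
    ∃ (E : Type) (_ : Field E) (_ : IsAlgClosed E) (_ : CharZero E)
      (φ : MvPolynomial τ (MvPolynomial α K) →+* PowerSeries E), Function.Injective φ ∧
        φ (C (linForm (β i))) = PowerSeries.X ∧
        (∀ j ∈ s, j ≠ i → IsUnit (φ (C (linForm (β j))))) ∧ ∀ w, IsUnit (φ (X w)) := by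
  obtain ⟨a₀, ha₀⟩ : ∃ a, β i a ≠ 0 := Function.ne_iff.1 hβi
  obtain ⟨E, _, _, ε, hε⟩ := exists_injective_ringHom_isAlgClosed
    (MvPolynomial τ (MvPolynomial α K))
  have : CharZero E := charZero_of_injective_ringHom (f := ε.comp (C.comp C))
    (hε.comp ((C_injective _ _).comp (C_injective _ _)))
  obtain ⟨η, hη, hηi, hηj, hηX⟩ := exists_ringHom_polynomial_linForm_eq_X (τ := τ) ha₀
  obtain ⟨φ, hφ⟩ : ∃ φ : MvPolynomial τ (MvPolynomial α K) →+* PowerSeries E,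
      ∀ q, φ q = ((η q).map ε : Polynomial E) :=
    ⟨(Polynomial.coeToPowerSeries.ringHom.comp (Polynomial.mapRingHom ε)).comp η, fun q => rfl⟩
  have hunit : ∀ q, (η q).coeff 0 ≠ 0 → IsUnit (φ q) := by
    intro q hq
    rw [PowerSeries.isUnit_iff_constantCoeff, hφ, Polynomial.constantCoeff_coe,
      Polynomial.coeff_map]
    exact ((map_ne_zero_iff ε hε).2 hq).isUnit
  refine ⟨E, inferInstance, inferInstance, this, φ, ?_, ?_, ?_, ?_⟩
  · rw [show (φ : _ → _) = fun q => ((η q).map ε : Polynomial E).toPowerSeries from funext hφ]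
    exact (Polynomial.coe_injective E).comp ((Polynomial.map_injective ε hε).comp hη)
  · rw [hφ, hηi, Polynomial.map_X, Polynomial.coe_X]
  · intro j hj hji
    apply hunit
    rw [hηj]
    intro h0
    refine hβ j hj hji (β j a₀ * (β i a₀)⁻¹) (linForm_injective ?_)
    rw [(map_eq_zero_iff _ (C_injective _ _)).1 h0]
    simp [linForm]
  · intro w
    apply hunit
    rw [hηX, Polynomial.coeff_C_zero]
    exact X_ne_zero w

theorem isPrime_span_radicalPoly_linForm [CharZero K] [Finite ι] [∀ i, Nonempty (κ i)]
    (l : ∀ i, κ i → ℕ) (hl : ∀ i j, 0 < l i j) (β : ι → α → K) (s : Set ι)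
    (hβ0 : ∀ i ∈ s, β i ≠ 0)
    (hβ : ∀ i ∈ s, ∀ j ∈ s, j ≠ i → ∀ x : K, (fun a => β j a - x * β i a) ≠ 0) :
    (Ideal.span (radicalPoly l (fun i => linForm (β i)) '' s)).IsPrime := by
  classical
  have := isPrime_span_radicalPoly l (fun i => linForm (β i)) hl s.toFinite.toFinset fun i hi =>
    exists_powerSeries_embedding β (s.toFinite.toFinset : Set ι) (hβ0 i (by simpa using hi))
      fun j hj hji => hβ i (by simpa using hi) j (by simpa using hj) hji
  rwa [Set.Finite.coe_toFinset] at this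

theorem exists_eval_ne_zero_of_radicalPoly [∀ i, Nonempty (κ i)]
    (l : ∀ i, κ i → ℕ) (hl : ∀ i j, 0 < l i j) (β : ι → α → K) (s : Set ι)
    (hβ0 : ∀ i ∈ s, β i ≠ 0) :
    ∃ (E : Type) (_ : Field E) (Φ : MvPolynomial (Σ i, κ i) (MvPolynomial α K) →+* E),
      (∀ p ∈ Ideal.span (radicalPoly l (fun i => linForm (β i)) '' s), Φ p = 0) ∧
      (∀ w, Φ (X w) ≠ 0) ∧ ∀ a, Φ (C (X a)) ≠ 0 := by
  classical
  obtain ⟨E, _, _, ε, hε⟩ := exists_injective_ringHom_isAlgClosed (MvPolynomial α K)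
  have j₁ : ∀ i, κ i := fun i => Classical.arbitrary _
  have hroot : ∀ i, ∃ ρ : E, ρ ≠ 0 ∧ (i ∈ s → ρ ^ l i (j₁ i) = ε (linForm (β i))) := by
    intro i
    by_cases hi : i ∈ s
    · obtain ⟨ρ, hρ⟩ := IsAlgClosed.exists_pow_nat_eq (ε (linForm (β i))) (hl i (j₁ i))
      refine ⟨ρ, ?_, fun _ => hρ⟩
      rintro rfl
      rw [zero_pow (hl i (j₁ i)).ne'] at hρ
      refine hβ0 i hi (linForm_injective (hε ?_))
      rw [← hρ]
      simp [linForm]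
    · exact ⟨1, one_ne_zero, fun h => absurd h hi⟩
  choose ρ hρ0 hρ using hroot
  let Φ : MvPolynomial (Σ i, κ i) (MvPolynomial α K) →+* E :=
    eval₂Hom ε fun w => if w.2 = j₁ w.1 then ρ w.1 else 1
  refine ⟨E, inferInstance, Φ, ?_, ?_, ?_⟩
  · have : Ideal.span (radicalPoly l (fun i => linForm (β i)) '' s) ≤ RingHom.ker Φ := by
      rw [Ideal.span_le]
      rintro _ ⟨i, hi, rfl⟩
      simp only [SetLike.mem_coe, RingHom.mem_ker]
      rw [eval₂Hom_radicalPoly, Finset.prod_eq_single (j₁ i)]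
      · simp [hρ i hi]
      · intro j _ hj
        simp [hj]
      · simp
    exact fun p hp => this hp
  · intro w
    simp only [Φ, eval₂Hom_X']
    split_ifs
    · exact hρ0 _
    · exact one_ne_zero
  · intro a
    simp only [Φ, eval₂Hom_C]
    exact (map_ne_zero_iff ε hε).2 (X_ne_zero a)

end LinearForms

section Columns

variable {𝕂 : Type} [Field 𝕂] {r c m : ℕ} {hcr : c ≤ r}

/-- The matrix defining `gPoly`, evaluated in a ring `D` via `a : 𝕂 →+* D` and
`y i` in place of `Tmon i`. -/
def relMatrix {D : Type*} [CommRing D] (hcr : c ≤ r) (a : 𝕂 →+* D)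
    (A : Matrix (Fin (c + 1)) (Fin (r + 1)) 𝕂) (y : Fin (r + 1) → D) (t : Fin (r - c)) :
    Matrix (Fin (c + 2)) (Fin (c + 2)) D :=
  Matrix.of fun q p =>
    if h : (q : ℕ) < c + 1 then a (A ⟨q, h⟩ (colOf r c hcr t p)) else y (colOf r c hcr t p)

theorem map_gPoly {D : Type*} [CommRing D] {nn : Fin (r + 1) → ℕ}
    (l : ∀ i : Fin (r + 1), Fin (nn i) → ℕ) (A : Matrix (Fin (c + 1)) (Fin (r + 1)) 𝕂)
    (t : Fin (r - c)) (ψ : MvPolynomial (VarIdx r m nn) 𝕂 →+* D) :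
    ψ (gPoly 𝕂 r c m hcr nn l A t) =
      (relMatrix hcr (ψ.comp C) A (fun i => ψ (Tmon 𝕂 r m nn l i)) t).det := by
  rw [gPoly, RingHom.map_det]
  congr 1
  ext q p
  simp only [RingHom.mapMatrix_apply, Matrix.map_apply, Matrix.of_apply, relMatrix]
  split_ifs <;> rfl

theorem snoc_vecMul_relMatrix {D : Type*} [CommRing D] (a : 𝕂 →+* D)
    (A : Matrix (Fin (c + 1)) (Fin (r + 1)) 𝕂) (y : Fin (r + 1) → D) (t : Fin (r - c))
    (ζ : Fin (c + 1) → D) (p : Fin (c + 2)) :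
    Matrix.vecMul (Fin.snoc (fun q => -ζ q) 1 : Fin (c + 2) → D) (relMatrix hcr a A y t) p =
      y (colOf r c hcr t p) - ∑ q, a (A q (colOf r c hcr t p)) * ζ q := by
  simp only [Matrix.vecMul, dotProduct, Fin.sum_univ_castSucc, Fin.snoc_castSucc, Fin.snoc_last,
    relMatrix, Matrix.of_apply, Fin.val_castSucc, Fin.is_lt, dite_true, Fin.val_last, lt_irrefl,
    dite_false, one_mul, neg_mul, Finset.sum_neg_distrib, Fin.eta]
  rw [neg_add_eq_sub]
  simp only [mul_comm]

theorem det_relMatrix_eq_sum {D : Type*} [CommRing D] (a : 𝕂 →+* D)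
    (A : Matrix (Fin (c + 1)) (Fin (r + 1)) 𝕂) (y : Fin (r + 1) → D) (t : Fin (r - c))
    (ζ : Fin (c + 1) → D) :
    (relMatrix hcr a A y t).det =
      ∑ p, (y (colOf r c hcr t p) - ∑ q, a (A q (colOf r c hcr t p)) * ζ q) *
        (relMatrix hcr a A y t).adjugate p (Fin.last (c + 1)) := by
  have h := congrFun (Matrix.vecMul_vecMul (Fin.snoc (fun q => -ζ q) 1 : Fin (c + 2) → D)
    (relMatrix hcr a A y t) (relMatrix hcr a A y t).adjugate) (Fin.last (c + 1))
  rw [Matrix.mul_adjugate, Matrix.vecMul_smul, Matrix.vecMul_one, Pi.smul_apply, Fin.snoc_last,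
    smul_eq_mul, mul_one] at h
  rw [← h]
  simp only [Matrix.vecMul, dotProduct]
  refine Finset.sum_congr rfl fun p _ => ?_
  rw [← snoc_vecMul_relMatrix]
  rfl

theorem det_relMatrix_eq_zero {D : Type*} [CommRing D] (a : 𝕂 →+* D)
    (A : Matrix (Fin (c + 1)) (Fin (r + 1)) 𝕂) (y : Fin (r + 1) → D) (ζ : Fin (c + 1) → D)
    (h : ∀ i, y i = ∑ q, a (A q i) * ζ q) (t : Fin (r - c)) :
    (relMatrix hcr a A y t).det = 0 := by
  rw [det_relMatrix_eq_sum a A y t ζ]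
  exact Finset.sum_eq_zero fun p _ => by rw [h, sub_self, zero_mul]

theorem isUnit_det_submatrix_castLE {A : Matrix (Fin (c + 1)) (Fin (r + 1)) 𝕂}
    (hcr' : c + 1 ≤ r + 1)
    (hA : ∀ s : Finset (Fin (r + 1)), s.card = c + 1 →
      LinearIndependent 𝕂 fun j : s => A.transpose (j : Fin (r + 1))) :
    IsUnit (A.submatrix id (Fin.castLE hcr')).det := by
  rw [← Matrix.isUnit_iff_isUnit_det, ← Matrix.linearIndependent_cols_iff_isUnit]
  exact (hA (Finset.univ.map (Fin.castLEEmb hcr')) (by simp)).comp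
    (fun j : Fin (c + 1) => ⟨Fin.castLE hcr' j, by simp⟩)
    fun i j hij => Fin.castLE_injective hcr' (congrArg Subtype.val hij)

theorem exists_eq_sum_of_det_relMatrix_eq_zero {D : Type*} [CommRing D] (a : 𝕂 →+* D)
    {A : Matrix (Fin (c + 1)) (Fin (r + 1)) 𝕂}
    (hA : ∀ s : Finset (Fin (r + 1)), s.card = c + 1 →
      LinearIndependent 𝕂 fun j : s => A.transpose (j : Fin (r + 1)))
    (y : Fin (r + 1) → D) (h : ∀ t, (relMatrix hcr a A y t).det = 0) :
    ∃ ζ : Fin (c + 1) → D, ∀ i, y i = ∑ q, a (A q i) * ζ q := by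
  have hcr' : c + 1 ≤ r + 1 := by omega
  set A₀ := A.submatrix id (Fin.castLE hcr') with hA₀
  have hdet : IsUnit A₀.det := isUnit_det_submatrix_castLE hcr' hA
  have hdetD : IsUnit (A₀.map a).det := by
    rw [← RingHom.mapMatrix_apply, ← RingHom.map_det]
    exact hdet.map a
  set ζ := Matrix.vecMul (fun p => y (Fin.castLE hcr' p)) (A₀.map a)⁻¹ with hζ
  have hlow : ∀ p, y (Fin.castLE hcr' p) = ∑ q, a (A q (Fin.castLE hcr' p)) * ζ q := by
    intro p
    have h1 : Matrix.vecMul ζ (A₀.map a) = fun p => y (Fin.castLE hcr' p) := by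
      rw [hζ, Matrix.vecMul_vecMul, Matrix.nonsing_inv_mul _ hdetD, Matrix.vecMul_one]
    rw [← congrFun h1 p]
    simp only [Matrix.vecMul, dotProduct, hA₀, Matrix.map_apply, Matrix.submatrix_apply, id]
    exact Finset.sum_congr rfl fun q _ => mul_comm _ _
  have hcol : ∀ (t : Fin (r - c)) (p : Fin (c + 1)),
      colOf r c hcr t p.castSucc = Fin.castLE hcr' p := by
    intro t p
    have : (p : ℕ) ≤ c := by omega
    simp only [colOf, Fin.val_castSucc, this, dite_true]
    rfl
  refine ⟨ζ, fun i => ?_⟩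
  by_cases hi : (i : ℕ) < c + 1
  · exact hlow ⟨i, hi⟩
  · obtain ⟨t, ht⟩ : ∃ t : Fin (r - c), colOf r c hcr t (Fin.last (c + 1)) = i :=
      ⟨⟨i - (c + 1), by omega⟩, by
        ext
        simp [colOf]
        omega⟩
    have h2 := h t
    rw [det_relMatrix_eq_sum a A y t ζ, Fin.sum_univ_castSucc, Finset.sum_eq_zero, zero_add, ht,
      Matrix.adjugate_fin_succ_eq_det_submatrix] at h2
    · have h3 : (relMatrix hcr a A y t).submatrix (Fin.last (c + 1)).succAbove
          (Fin.last (c + 1)).succAbove = A₀.map a := by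
        ext q p
        simp [relMatrix, hA₀, hcol, Nat.lt_succ_iff.1 q.isLt]
      rw [h3, ((IsUnit.pow _ isUnit_one.neg).mul hdetD).mul_left_eq_zero, sub_eq_zero] at h2
      exact h2
    · intro p _
      rw [hcol, hlow, sub_self, zero_mul]

theorem eq_zero_of_columns_combination {A : Matrix (Fin (c + 1)) (Fin (r + 1)) 𝕂} (hcr : c ≤ r)
    (hc2 : 2 ≤ c) (hA : ∀ s : Finset (Fin (r + 1)), s.card = c + 1 →
      LinearIndependent 𝕂 fun j : s => A.transpose (j : Fin (r + 1)))
    {i j k : Fin (r + 1)} (hij : i ≠ j) (hik : i ≠ k) {x y z : 𝕂}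
    (h : ∀ q, x * A q i + y * A q j + z * A q k = 0) : x = 0 := by
  have hcard : ({i, j, k} : Finset (Fin (r + 1))).card ≤ c + 1 :=
    Finset.card_le_three.trans (by omega)
  obtain ⟨s, hs, hsc⟩ := Finset.exists_superset_card_eq hcard (by simpa using hcr)
  have hmem : ∀ p ∈ ({i, j, k} : Finset (Fin (r + 1))), p ∈ s := fun p hp => hs hp
  have hi : i ∈ s := hmem i (by simp)
  have hj : j ∈ s := hmem j (by simp)
  have hk : k ∈ s := hmem k (by simp)
  have h1 := Fintype.linearIndependent_iff.1 (hA s hsc)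
    (Pi.single ⟨i, hi⟩ x + Pi.single ⟨j, hj⟩ y + Pi.single ⟨k, hk⟩ z) (by
      simp only [Pi.add_apply, add_smul, Finset.sum_add_distrib, Pi.single_apply, ite_smul,
        zero_smul, Finset.sum_ite_eq', Finset.mem_univ, if_true]
      funext q
      simpa using h q) ⟨i, hi⟩
  simpa [Pi.single_apply, hij, hik] using h1

end Columns

section Variables

variable {𝕂 : Type} [Field 𝕂] {r c m : ℕ} {nn : Fin (r + 1) → ℕ}

theorem exists_column_projection {A : Matrix (Fin (c + 1)) (Fin (r + 1)) 𝕂} (hcr : c ≤ r)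
    (hc2 : 2 ≤ c) (hA : ∀ s : Finset (Fin (r + 1)), s.card = c + 1 →
      LinearIndependent 𝕂 fun j : s => A.transpose (j : Fin (r + 1)))
    (s : Set (Fin (r + 1))) (hs : sᶜ.Subsingleton) :
    ∃ (b μ : Fin (c + 1) → 𝕂) (β : Fin (r + 1) → Fin (c + 1) → 𝕂),
      (∀ i q, β i q = A q i - (∑ q', A q' i * μ q') * b q) ∧ (∀ i ∉ s, β i = 0) ∧
      (∀ i ∈ s, β i ≠ 0) ∧
      (∀ i ∈ s, ∀ j ∈ s, j ≠ i → ∀ x : 𝕂, (fun q => β j q - x * β i q) ≠ 0) ∧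
      (b = 0 ∨ ∃ i ∉ s, ∀ q, b q = A q i) := by
  have : Nontrivial (Fin (r + 1)) := Fin.nontrivial_iff_two_le.2 (by omega)
  rcases hs.eq_empty_or_singleton with h | ⟨i₀, h⟩
  · have h' : ∀ i, i ∈ s := by
      rw [Set.compl_empty_iff] at h
      simp [h]
    refine ⟨0, 0, fun i q => A q i, by simp, fun i hi => absurd (h' i) hi, fun i _ h0 => ?_,
      fun i _ j _ hji x h0 => ?_, Or.inl rfl⟩
    · obtain ⟨j, hj⟩ := exists_ne i
      refine one_ne_zero (eq_zero_of_columns_combination hcr hc2 hA hj.symm hj.symm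
        (x := (1 : 𝕂)) (y := 0) (z := 0) fun q => ?_)
      simpa using congrFun h0 q
    · refine one_ne_zero (eq_zero_of_columns_combination hcr hc2 hA hji hji
        (x := (1 : 𝕂)) (y := -x) (z := 0) fun q => ?_)
      have := congrFun h0 q
      simp only [Pi.zero_apply] at this
      linear_combination this
  · have hmem : ∀ i, i ∈ s ↔ i ≠ i₀ := fun i => by
      rw [← not_iff_not, ← Set.mem_compl_iff, h, Set.mem_singleton_iff, not_not]
    obtain ⟨q₀, hq₀⟩ : ∃ q₀, A q₀ i₀ ≠ 0 := by
      by_contra! h0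
      obtain ⟨j, hj⟩ := exists_ne i₀
      exact one_ne_zero (eq_zero_of_columns_combination hcr hc2 hA hj.symm hj.symm
        (x := (1 : 𝕂)) (y := 0) (z := 0) fun q => by simp [h0])
    refine ⟨fun q => A q i₀, Pi.single q₀ (A q₀ i₀)⁻¹,
      fun i q => A q i - A q₀ i * (A q₀ i₀)⁻¹ * A q i₀, ?_, ?_, ?_, ?_,
      Or.inr ⟨i₀, by simp [hmem], fun _ => rfl⟩⟩
    · intro i q
      simp [Pi.single_apply]
    · intro i hi
      obtain rfl : i = i₀ := by simpa [hmem] using hi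
      funext q
      simp [mul_inv_cancel₀ hq₀]
    · intro i hi h0
      refine one_ne_zero (eq_zero_of_columns_combination hcr hc2 hA ((hmem i).1 hi)
        ((hmem i).1 hi) (x := (1 : 𝕂)) (y := -(A q₀ i * (A q₀ i₀)⁻¹)) (z := 0) fun q => ?_)
      have := congrFun h0 q
      simp only [Pi.zero_apply] at this
      linear_combination this
    · intro i _ j hj hji x h0
      refine one_ne_zero (eq_zero_of_columns_combination hcr hc2 hA hji ((hmem j).1 hj)
        (x := (1 : 𝕂)) (y := -x)
        (z := x * (A q₀ i * (A q₀ i₀)⁻¹) - A q₀ j * (A q₀ i₀)⁻¹) fun q => ?_)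
      have := congrFun h0 q
      simp only [Pi.zero_apply] at this
      linear_combination this

/-- The ideal generated by the relations `gPoly` together with the variable `X v`. -/
noncomputable def relIdealWithVar (hcr : c ≤ r) (l : ∀ i : Fin (r + 1), Fin (nn i) → ℕ)
    (A : Matrix (Fin (c + 1)) (Fin (r + 1)) 𝕂) (v : VarIdx r m nn) :
    Ideal (MvPolynomial (VarIdx r m nn) 𝕂) :=
  Ideal.span (Set.range (gPoly 𝕂 r c m hcr nn l A)) ⊔ Ideal.span {X v}

theorem sum_map_sub_mul_mul {ι R D : Type*} [Fintype ι] [CommRing R] [CommRing D] (α : R →+* D)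
    (a b μ : ι → R) (z : ι → D) :
    ∑ q, α (a q - (∑ q', a q' * μ q') * b q) * z q =
      ∑ q, α (a q) * (z q - α (μ q) * ∑ q', α (b q') * z q') := by
  simp only [map_sub, map_mul, map_sum, sub_mul, mul_sub, Finset.sum_sub_distrib, mul_assoc,
    ← Finset.mul_sum]
  simp only [← mul_assoc, ← Finset.sum_mul]

theorem relIdealWithVar_le_ker {D : Type*} [CommRing D] (hcr : c ≤ r)
    (l : ∀ i : Fin (r + 1), Fin (nn i) → ℕ) (A : Matrix (Fin (c + 1)) (Fin (r + 1)) 𝕂)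
    {v : VarIdx r m nn} (α : 𝕂 →+* D) (x : VarIdx r m nn → D) (hxv : x v = 0)
    (ζ : Fin (c + 1) → D)
    (hζ : ∀ i, ∏ j, x (Sum.inl ⟨i, j⟩) ^ l i j = ∑ q, α (A q i) * ζ q) :
    relIdealWithVar hcr l A v ≤ RingHom.ker (eval₂Hom α x) := by
  refine sup_le (Ideal.span_le.2 ?_) (Ideal.span_le.2 (by simpa using hxv))
  rintro _ ⟨t, rfl⟩
  change eval₂Hom α x _ = 0
  rw [map_gPoly, show (eval₂Hom α x).comp C = α by ext; simp]
  refine det_relMatrix_eq_zero α A _ ζ (fun i => ?_) t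
  rw [← hζ, Tmon, map_prod]
  simp only [map_pow, eval₂Hom_X']

theorem mk_relIdealWithVar_X (hcr : c ≤ r) (l : ∀ i : Fin (r + 1), Fin (nn i) → ℕ)
    (A : Matrix (Fin (c + 1)) (Fin (r + 1)) 𝕂) (v : VarIdx r m nn) :
    Ideal.Quotient.mk (relIdealWithVar hcr l A v) (X v) = 0 :=
  Ideal.Quotient.eq_zero_iff_mem.2 (Ideal.mem_sup_right (Ideal.mem_span_singleton_self _))

theorem exists_mk_relIdealWithVar_eq_sum (hcr : c ≤ r) (l : ∀ i : Fin (r + 1), Fin (nn i) → ℕ)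
    {A : Matrix (Fin (c + 1)) (Fin (r + 1)) 𝕂}
    (hA : ∀ s : Finset (Fin (r + 1)), s.card = c + 1 →
      LinearIndependent 𝕂 fun j : s => A.transpose (j : Fin (r + 1)))
    (v : VarIdx r m nn) :
    ∃ ζ : Fin (c + 1) → MvPolynomial (VarIdx r m nn) 𝕂 ⧸ relIdealWithVar hcr l A v,
      ∀ i, ∏ j, Ideal.Quotient.mk (relIdealWithVar hcr l A v) (X (Sum.inl ⟨i, j⟩)) ^ l i j =
        ∑ q, (Ideal.Quotient.mk (relIdealWithVar hcr l A v)).comp C (A q i) * ζ q := by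
  refine exists_eq_sum_of_det_relMatrix_eq_zero (hcr := hcr) _ hA _ fun t => ?_
  have h : Ideal.Quotient.mk (relIdealWithVar hcr l A v) (gPoly 𝕂 r c m hcr nn l A t) = 0 :=
    Ideal.Quotient.eq_zero_iff_mem.2 (Ideal.mem_sup_left (Ideal.subset_span ⟨t, rfl⟩))
  rw [map_gPoly] at h
  simpa only [Tmon, map_prod, map_pow] using h

theorem isPrime_relIdealWithVar [CharZero 𝕂] (hcr : c ≤ r) (hc2 : 2 ≤ c) (hnn : ∀ i, 0 < nn i)
    {l : ∀ i : Fin (r + 1), Fin (nn i) → ℕ} (hl : ∀ i j, 0 < l i j)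
    {A : Matrix (Fin (c + 1)) (Fin (r + 1)) 𝕂}
    (hA : ∀ s : Finset (Fin (r + 1)), s.card = c + 1 →
      LinearIndependent 𝕂 fun j : s => A.transpose (j : Fin (r + 1)))
    (v : VarIdx r m nn) :
    (relIdealWithVar hcr l A v).IsPrime ∧ ∀ w, w ≠ v → X w ∉ relIdealWithVar hcr l A v := by
  have : ∀ i, Nonempty (Fin (nn i)) := fun i => ⟨⟨0, hnn i⟩⟩
  set s : Set (Fin (r + 1)) := {i | ∀ j, v ≠ Sum.inl ⟨i, j⟩} with hs
  have hsc : sᶜ.Subsingleton := by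
    intro i hi i' hi'
    simp only [hs, Set.mem_compl_iff, Set.mem_ofPred_eq, not_forall, not_not] at hi hi'
    obtain ⟨j, rfl⟩ := hi
    obtain ⟨j', h⟩ := hi'
    exact congrArg Sigma.fst (Sum.inl_injective h)
  obtain ⟨b, μ, β, hβ, hβs, hβ0, hββ, hb⟩ := exists_column_projection hcr hc2 hA s hsc
  set γ : Fin (r + 1) → Fin (c + 1) ⊕ Fin m → 𝕂 := fun i => Sum.elim (β i) 0 with hγ
  have hγ0 : ∀ i ∈ s, γ i ≠ 0 := fun i hi h => hβ0 i hi (funext fun q => congrFun h (Sum.inl q))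
  set J := Ideal.span (radicalPoly l (fun i => linForm (γ i)) '' s) with hJ
  have hJp : J.IsPrime := isPrime_span_radicalPoly_linForm l hl γ s hγ0
    fun i hi j hj hji x h => hββ i hi j hj hji x (funext fun q => congrFun h (Sum.inl q))
  have hfst : ∀ {i}, i ∉ s → ∃ j, v = Sum.inl ⟨i, j⟩ := fun {i} hi => by
    simpa [hs] using hi
  -- The ideal is the kernel of the evaluation at `x`.
  let α : 𝕂 →+* (MvPolynomial (Σ i, Fin (nn i)) (MvPolynomial (Fin (c + 1) ⊕ Fin m) 𝕂) ⧸ J) :=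
    (Ideal.Quotient.mk J).comp (C.comp C)
  let z : Fin (c + 1) ⊕ Fin m →
      (MvPolynomial (Σ i, Fin (nn i)) (MvPolynomial (Fin (c + 1) ⊕ Fin m) 𝕂) ⧸ J) :=
    fun a => Ideal.Quotient.mk J (C (X a))
  let x : VarIdx r m nn →
      (MvPolynomial (Σ i, Fin (nn i)) (MvPolynomial (Fin (c + 1) ⊕ Fin m) 𝕂) ⧸ J) :=
    fun w => if w = v then 0 else
      Sum.elim (fun w => Ideal.Quotient.mk J (X w)) (fun k => z (Sum.inr k)) w
  have hx : ∀ i, ∏ j, x (Sum.inl ⟨i, j⟩) ^ l i j = ∑ q, α (β i q) * z (Sum.inl q) := by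
    intro i
    by_cases hi : i ∈ s
    · have h1 : Ideal.Quotient.mk J (radicalPoly l (fun i => linForm (γ i)) i) = 0 :=
        Ideal.Quotient.eq_zero_iff_mem.2 (Ideal.subset_span ⟨i, hi, rfl⟩)
      have h2 : Ideal.Quotient.mk J (C (linForm (γ i))) = ∑ q, α (β i q) * z (Sum.inl q) := by
        simp [linForm, hγ, α, z, map_sum]
      rw [radicalPoly, map_sub, sub_eq_zero, h2, map_prod] at h1
      rw [← h1]
      refine Finset.prod_congr rfl fun j _ => ?_
      rw [map_pow]
      simp only [x, if_neg (hi j).symm, Sum.elim_inl]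
    · obtain ⟨j, hj⟩ := hfst hi
      rw [hβs i hi]
      simp only [Pi.zero_apply, map_zero, zero_mul, Finset.sum_const_zero]
      refine Finset.prod_eq_zero (Finset.mem_univ j) ?_
      simp only [x, if_pos hj.symm, zero_pow (hl i j).ne']
  have hIψ : relIdealWithVar hcr l A v ≤ RingHom.ker (eval₂Hom α x) := by
    refine relIdealWithVar_le_ker hcr l A α x (if_pos rfl)
      (fun q => z (Sum.inl q) - α (μ q) * ∑ q', α (b q') * z (Sum.inl q')) (fun i => ?_)
    rw [hx]
    simp only [hβ]
    exact sum_map_sub_mul_mul α (fun q => A q i) b μ fun q => z (Sum.inl q)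
  -- The evaluation is invertible modulo the ideal.
  obtain ⟨ζ, hζ⟩ := exists_mk_relIdealWithVar_eq_sum hcr l hA v
  have hbζ : ∑ q, (Ideal.Quotient.mk (relIdealWithVar hcr l A v)).comp C (b q) * ζ q = 0 := by
    rcases hb with rfl | ⟨i, hi, hbi⟩
    · simp
    · obtain ⟨j, hj⟩ := hfst hi
      simp only [hbi]
      rw [← hζ i]
      refine Finset.prod_eq_zero (Finset.mem_univ j) ?_
      rw [← hj, mk_relIdealWithVar_X, zero_pow (hl i j).ne']
  let θ : MvPolynomial (Σ i, Fin (nn i)) (MvPolynomial (Fin (c + 1) ⊕ Fin m) 𝕂) →+*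
      MvPolynomial (VarIdx r m nn) 𝕂 ⧸ relIdealWithVar hcr l A v :=
    eval₂Hom (eval₂Hom ((Ideal.Quotient.mk (relIdealWithVar hcr l A v)).comp C)
      (Sum.elim ζ (fun k => Ideal.Quotient.mk (relIdealWithVar hcr l A v) (X (Sum.inr k)))))
      (fun w => Ideal.Quotient.mk (relIdealWithVar hcr l A v) (X (Sum.inl w)))
  have hθJ : J ≤ RingHom.ker θ := by
    refine Ideal.span_le.2 ?_
    rintro _ ⟨i, _, rfl⟩
    change θ _ = 0
    rw [eval₂Hom_radicalPoly, eval₂Hom_linForm, Fintype.sum_sum_type, hζ i]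
    simp only [hγ, Sum.elim_inl, Sum.elim_inr, Pi.zero_apply, map_zero, zero_mul,
      Finset.sum_const_zero, add_zero, hβ, map_sub, map_mul, sub_mul,
      Finset.sum_sub_distrib, mul_assoc, ← Finset.mul_sum, hbζ, mul_zero, sub_zero, sub_self]
  have hcomp : (Ideal.Quotient.lift J θ hθJ).comp (eval₂Hom α x) =
      Ideal.Quotient.mk (relIdealWithVar hcr l A v) := by
    refine MvPolynomial.ringHom_ext (fun y => ?_) fun w => ?_
    · rw [RingHom.comp_apply, eval₂Hom_C]
      refine (Ideal.Quotient.lift_mk J θ hθJ).trans ?_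
      simp [θ]
    · rw [RingHom.comp_apply, eval₂Hom_X']
      by_cases hw : w = v
      · rw [hw, mk_relIdealWithVar_X]
        simp [x]
      · simp only [x, if_neg hw]
        rcases w with w | k <;>
          exact (Ideal.Quotient.lift_mk J θ hθJ).trans (by simp [θ])
  have hker : relIdealWithVar hcr l A v = RingHom.ker (eval₂Hom α x) := by
    refine le_antisymm hIψ fun p hp => Ideal.Quotient.eq_zero_iff_mem.1 ?_
    rw [← hcomp, RingHom.comp_apply, RingHom.mem_ker.1 hp, map_zero]
  rw [hker]
  refine ⟨RingHom.ker_isPrime _, fun w hw hmem => ?_⟩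
  obtain ⟨E, _, Φ, hΦ, hΦX, hΦC⟩ := exists_eval_ne_zero_of_radicalPoly l hl γ s hγ0
  rw [RingHom.mem_ker, eval₂Hom_X'] at hmem
  simp only [x, if_neg hw] at hmem
  rcases w with w | k
  · exact hΦX w (hΦ _ (Ideal.Quotient.eq_zero_iff_mem.1 hmem))
  · exact hΦC (Sum.inr k) (hΦ _ (Ideal.Quotient.eq_zero_iff_mem.1 hmem))

theorem mk_X_dvd_iff (hcr : c ≤ r) (l : ∀ i : Fin (r + 1), Fin (nn i) → ℕ)
    (A : Matrix (Fin (c + 1)) (Fin (r + 1)) 𝕂) (v : VarIdx r m nn)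
    (p : MvPolynomial (VarIdx r m nn) 𝕂) :
    Ideal.Quotient.mk (Ideal.span (Set.range (gPoly 𝕂 r c m hcr nn l A))) (X v) ∣
      Ideal.Quotient.mk (Ideal.span (Set.range (gPoly 𝕂 r c m hcr nn l A))) p ↔
      p ∈ relIdealWithVar hcr l A v := by
  rw [← Ideal.mem_span_singleton, ← Set.image_singleton, ← Ideal.map_span, relIdealWithVar,
    sup_comm, ← Ideal.mem_quotient_iff_mem_sup]

theorem prime_mk_X [CharZero 𝕂] (hcr : c ≤ r) (hc2 : 2 ≤ c) (hnn : ∀ i, 0 < nn i)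
    {l : ∀ i : Fin (r + 1), Fin (nn i) → ℕ} (hl : ∀ i j, 0 < l i j)
    {A : Matrix (Fin (c + 1)) (Fin (r + 1)) 𝕂}
    (hA : ∀ s : Finset (Fin (r + 1)), s.card = c + 1 →
      LinearIndependent 𝕂 fun j : s => A.transpose (j : Fin (r + 1)))
    (v : VarIdx r m nn) :
    Prime (Ideal.Quotient.mk (Ideal.span (Set.range (gPoly 𝕂 r c m hcr nn l A))) (X v)) := by
  obtain ⟨hp, -⟩ := isPrime_relIdealWithVar hcr hc2 hnn hl hA v
  refine ⟨fun h0 => ?_, fun hu => ?_, fun x y hxy => ?_⟩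
  · obtain ⟨w, hw⟩ : ∃ w : VarIdx r m nn, v ≠ w := by
      by_contra! h
      have h1 := (h (Sum.inl ⟨0, 0, hnn 0⟩)).symm.trans (h (Sum.inl ⟨Fin.last r, 0, hnn _⟩))
      have h2 := congrArg Fin.val (congrArg Sigma.fst (Sum.inl_injective h1))
      simp at h2
      omega
    exact (isPrime_relIdealWithVar hcr hc2 hnn hl hA w).2 v hw
      (Ideal.mem_sup_left (Ideal.Quotient.eq_zero_iff_mem.1 h0))
  · refine hp.ne_top ((Ideal.eq_top_iff_one _).2 ((mk_X_dvd_iff hcr l A v 1).1 ?_))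
    exact hu.dvd
  · obtain ⟨x, rfl⟩ := Ideal.Quotient.mk_surjective x
    obtain ⟨y, rfl⟩ := Ideal.Quotient.mk_surjective y
    rw [← map_mul, mk_X_dvd_iff] at hxy
    rw [mk_X_dvd_iff, mk_X_dvd_iff]
    exact hp.mem_or_mem hxy

end Variables

/-- If `c ≥ 2`, then the image in
`R = 𝕂[T_{ij},S_k]/⟨g_1,…,g_{r−c}⟩` of each variable `T_{ij}`, `S_k` is a prime
element, and the images of any two distinct variables are non-associated. -/
theorem statement_5
    (𝕂 : Type) [Field 𝕂] [IsAlgClosed 𝕂] [CharZero 𝕂]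
    (r c m : ℕ) (hc : 0 < c) (hcr : c ≤ r)
    (nn : Fin (r + 1) → ℕ) (hnn : ∀ i, 0 < nn i)
    (l : ∀ i : Fin (r + 1), Fin (nn i) → ℕ) (hl : ∀ i j, 0 < l i j)
    (A : Matrix (Fin (c + 1)) (Fin (r + 1)) 𝕂)
    (hA : ∀ s : Finset (Fin (r + 1)), s.card = c + 1 →
      LinearIndependent 𝕂 fun j : s => A.transpose (j : Fin (r + 1)))
    (hc2 : 2 ≤ c) :
    (∀ v : VarIdx r m nn,
      Prime (Ideal.Quotient.mk (Ideal.span (Set.range (gPoly 𝕂 r c m hcr nn l A))) (X v))) ∧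
    (∀ v w : VarIdx r m nn, v ≠ w →
      ¬ Associated
        (Ideal.Quotient.mk (Ideal.span (Set.range (gPoly 𝕂 r c m hcr nn l A))) (X v))
        (Ideal.Quotient.mk (Ideal.span (Set.range (gPoly 𝕂 r c m hcr nn l A))) (X w))) := by
  exact ⟨fun v => prime_mk_X hcr hc2 hnn hl hA v, fun v w hvw h =>
    (isPrime_relIdealWithVar hcr hc2 hnn hl hA v).2 w hvw.symm
      ((mk_X_dvd_iff hcr l A v _).1 h.dvd)⟩
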